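/- (Johnson–Lindenstrauss lemma) For any 0 < ε < 1 and any integer n ≥ 2, if d' ≥ 24 log n / (3ε² − 2ε³), then for any set A of n points in ℝ^d there exists a map f : ℝ^d → ℝ^{d'} such that (1−ε)‖x−y‖² ≤ ‖f(x)−f(y)‖² ≤ (1+ε)‖x−y‖² for all x, y ∈ A. -/

import Mathlib

open MeasureTheory ProbabilityTheory

/-- The moment generating function of a chi-squared variable with one degree of freedom. -/
lemma integral_exp_mul_sq_gaussianReal {t : ℝ} (ht : t < 1 / 2) :
    ∫ x, Real.exp (t * x ^ 2) ∂(gaussianReal 0 1) = √(1 / (1 - 2 * t)) := by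
  rw [integral_gaussianReal_eq_integral_smul one_ne_zero]
  have hint : ∀ x : ℝ, gaussianPDFReal 0 1 x • Real.exp (t * x ^ 2)
      = (√(2 * Real.pi))⁻¹ * Real.exp (-(1 / 2 - t) * x ^ 2) := by
    intro x
    simp only [gaussianPDFReal, NNReal.coe_one, mul_one, sub_zero, smul_eq_mul]
    rw [mul_assoc, ← Real.exp_add]
    congr 2
    ring
  simp_rw [hint]
  have h1 : (0 : ℝ) < 1 - 2 * t := by linarith
  have h2 : (1 : ℝ) / 2 - t ≠ 0 := by linarith
  rw [integral_const_mul, integral_gaussian, ← Real.sqrt_inv,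
    ← Real.sqrt_mul (by positivity)]
  congr 1
  have := Real.pi_ne_zero
  have := h1.ne'
  rw [inv_mul_eq_div, div_div, div_eq_div_iff (by positivity) (by positivity)]
  ring

section GaussianProjection

variable {E ι : Type*} [NormedAddCommGroup E] [InnerProductSpace ℝ E] [FiniteDimensional ℝ E]
  [MeasurableSpace E] [BorelSpace E] [Fintype ι]

lemma map_inner_stdGaussian {u : E} (hu : ‖u‖ = 1) :
    (stdGaussian E).map (fun x ↦ inner ℝ u x) = gaussianReal 0 1 := by
  have h := IsGaussian.map_eq_gaussianReal (μ := stdGaussian E) (innerSL ℝ u)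
  rw [integral_strongDual_stdGaussian, variance_dual_stdGaussian, innerSL_apply_norm, hu] at h
  simpa using h

lemma mgf_sum_inner_sq {u : E} (hu : ‖u‖ = 1) {t : ℝ} (ht : t < 1 / 2) :
    mgf (fun g : ι → E ↦ ∑ i, (inner ℝ u (g i)) ^ 2) (Measure.pi fun _ ↦ stdGaussian E) t
      = √(1 / (1 - 2 * t)) ^ Fintype.card ι := by
  simp only [mgf, Finset.mul_sum, Real.exp_sum]
  rw [integral_fintype_prod_eq_pow (fun x : E ↦ Real.exp (t * (inner ℝ u x) ^ 2)),
    ← integral_exp_mul_sq_gaussianReal ht, ← map_inner_stdGaussian hu,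
    integral_map (by fun_prop) (by fun_prop)]

lemma integrable_exp_mul_sum_inner_sq {u : E} (hu : ‖u‖ = 1) {t : ℝ} (ht : t < 1 / 2) :
    Integrable (fun g : ι → E ↦ Real.exp (t * ∑ i, (inner ℝ u (g i)) ^ 2))
      (Measure.pi fun _ ↦ stdGaussian E) := by
  apply Integrable.of_integral_ne_zero
  have h := mgf_sum_inner_sq (ι := ι) hu ht
  rw [mgf] at h
  rw [h]
  have : (0 : ℝ) < 1 - 2 * t := by linarith
  positivity

lemma exp_mul_sqrt_pow {s : ℝ} (hs : -1 < s) (k : ℕ) :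
    Real.exp (-(s / (2 * (1 + s))) * (k * (1 + s)))
        * √(1 / (1 - 2 * (s / (2 * (1 + s))))) ^ k
      = Real.exp (k / 2 * (Real.log (1 + s) - s)) := by
  have h : 0 < 1 + s := by linarith
  have h1 : 1 / (1 - 2 * (s / (2 * (1 + s)))) = 1 + s := by
    have : 1 - 2 * (s / (2 * (1 + s))) = 1 / (1 + s) := by field_simp; ring
    rw [this, one_div_one_div]
  rw [h1, Real.sqrt_eq_rpow, Real.rpow_def_of_pos h, ← Real.exp_nat_mul, ← Real.exp_add]
  congr 1
  field_simp
  ring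

lemma measureReal_le_sum_inner_sq {u : E} (hu : ‖u‖ = 1) {ε : ℝ} (hε : 0 ≤ ε) :
    (Measure.pi fun _ : ι ↦ stdGaussian E).real
        {g | Fintype.card ι * (1 + ε) ≤ ∑ i, (inner ℝ u (g i)) ^ 2}
      ≤ Real.exp (Fintype.card ι / 2 * (Real.log (1 + ε) - ε)) := by
  have ht : ε / (2 * (1 + ε)) < 1 / 2 := by
    rw [div_lt_div_iff₀ (by positivity) (by positivity)]; linarith
  have h := measure_ge_le_exp_mul_mgf (Fintype.card ι * (1 + ε)) (by positivity)
    (integrable_exp_mul_sum_inner_sq (ι := ι) hu ht)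
  rwa [mgf_sum_inner_sq hu ht, exp_mul_sqrt_pow (by linarith)] at h

lemma measureReal_sum_inner_sq_le {u : E} (hu : ‖u‖ = 1) {ε : ℝ} (hε : 0 ≤ ε) (hε1 : ε < 1) :
    (Measure.pi fun _ : ι ↦ stdGaussian E).real
        {g | ∑ i, (inner ℝ u (g i)) ^ 2 ≤ Fintype.card ι * (1 - ε)}
      ≤ Real.exp (Fintype.card ι / 2 * (Real.log (1 - ε) + ε)) := by
  have hpos : 0 < 1 + -ε := by linarith
  have ht0 : -ε / (2 * (1 + -ε)) ≤ 0 :=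
    div_nonpos_of_nonpos_of_nonneg (by linarith) (by positivity)
  have ht : -ε / (2 * (1 + -ε)) < 1 / 2 := by linarith
  have h := measure_le_le_exp_mul_mgf (Fintype.card ι * (1 + -ε)) ht0
    (integrable_exp_mul_sum_inner_sq (ι := ι) hu ht)
  rw [mgf_sum_inner_sq hu ht, exp_mul_sqrt_pow (by linarith)] at h
  simpa only [sub_neg_eq_add, ← sub_eq_add_neg] using h

end GaussianProjection

lemma log_one_add_le_cubic {x : ℝ} (hx : 0 ≤ x) :
    Real.log (1 + x) ≤ x - x ^ 2 / 2 + x ^ 3 / 3 := by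
  have hder : ∀ y : ℝ, 0 ≤ y → HasDerivAt
      (fun y ↦ y - y ^ 2 / 2 + y ^ 3 / 3 - Real.log (1 + y)) (y ^ 3 / (1 + y)) y := by
    intro y hy
    have h1 : 1 + y ≠ 0 := by positivity
    have h := ((((hasDerivAt_id y).sub ((hasDerivAt_pow 2 y).div_const 2)).add
      ((hasDerivAt_pow 3 y).div_const 3)).sub (((hasDerivAt_id y).const_add 1).log h1))
    refine h.congr_deriv ?_
    simp only [id]
    field_simp
    ring
  have hmono : MonotoneOn (fun y : ℝ ↦ y - y ^ 2 / 2 + y ^ 3 / 3 - Real.log (1 + y))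
      (Set.Ici 0) := by
    refine monotoneOn_of_hasDerivWithinAt_nonneg (f' := fun y ↦ y ^ 3 / (1 + y)) (convex_Ici 0)
      (fun y hy ↦ (hder y hy).continuousAt.continuousWithinAt) ?_ ?_
    · intro y hy
      exact (hder y (interior_subset hy)).hasDerivWithinAt
    · intro y hy
      have : (0 : ℝ) ≤ y := interior_subset hy
      positivity
  have h := hmono (Set.mem_Ici.2 le_rfl) hx hx
  norm_num at h
  linarith

lemma log_one_sub_le_quadratic {x : ℝ} (hx : 0 ≤ x) (hx1 : x < 1) :
    Real.log (1 - x) ≤ -x - x ^ 2 / 2 := by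
  have h := sum_le_hasSum (Finset.range 2) (fun i _ ↦ by positivity)
    (Real.hasSum_pow_div_log_of_abs_lt_one (abs_lt.2 ⟨by linarith, hx1⟩))
  norm_num [Finset.sum_range_succ] at h
  linarith

/-- A random Gaussian linear map violates each one-sided distortion bound on a given nonzero
vector with probability at most `1 / n ^ 2`. -/
lemma measureReal_distortion_le {ε : ℝ} (hε0 : 0 < ε) (hε1 : ε < 1) {n : ℕ} (hn : 0 < n)
    {d k : ℕ} (hk : 24 * Real.log n / (3 * ε ^ 2 - 2 * ε ^ 3) ≤ k)
    {v : EuclideanSpace ℝ (Fin d)} (hv : v ≠ 0) :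
    (Measure.pi fun _ : Fin k ↦ stdGaussian (EuclideanSpace ℝ (Fin d))).real
        {g | k * (1 + ε) * ‖v‖ ^ 2 ≤ ∑ i, (inner ℝ v (g i)) ^ 2} ≤ 1 / (n : ℝ) ^ 2 ∧
    (Measure.pi fun _ : Fin k ↦ stdGaussian (EuclideanSpace ℝ (Fin d))).real
        {g | ∑ i, (inner ℝ v (g i)) ^ 2 ≤ k * (1 - ε) * ‖v‖ ^ 2} ≤ 1 / (n : ℝ) ^ 2 := by
  have hden : 0 < 3 * ε ^ 2 - 2 * ε ^ 3 := by nlinarith [pow_pos hε0 2]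
  rw [div_le_iff₀ hden] at hk
  have hn' : (0 : ℝ) < n := by exact_mod_cast hn
  have hexp : ∀ a : ℝ, a ≤ -(ε ^ 2 / 2 - ε ^ 3 / 3) →
      Real.exp (k / 2 * a) ≤ 1 / (n : ℝ) ^ 2 := by
    intro a ha
    have : (1 : ℝ) / n ^ 2 = Real.exp (-(2 * Real.log n)) := by
      rw [Real.exp_neg, two_mul, Real.exp_add, Real.exp_log hn']
      field_simp
    rw [this, Real.exp_le_exp]
    have := mul_le_mul_of_nonneg_left ha (by positivity : (0 : ℝ) ≤ k / 2)
    linarith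
  have hv' : 0 < ‖v‖ := norm_pos_iff.2 hv
  have hu : ‖(‖v‖⁻¹ • v)‖ = 1 := by
    rw [norm_smul, norm_inv, norm_norm, inv_mul_cancel₀ hv'.ne']
  have hsum : ∀ g : Fin k → EuclideanSpace ℝ (Fin d),
      ∑ i, (inner ℝ v (g i)) ^ 2 = (∑ i, (inner ℝ (‖v‖⁻¹ • v) (g i)) ^ 2) * ‖v‖ ^ 2 := by
    intro g
    rw [Finset.sum_mul]
    refine Finset.sum_congr rfl fun i _ ↦ ?_
    rw [real_inner_smul_left]
    field_simp
  simp only [hsum, mul_le_mul_iff_left₀ (pow_pos hv' 2)]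
  constructor
  · have h := measureReal_le_sum_inner_sq (ι := Fin k) hu hε0.le
    rw [Fintype.card_fin] at h
    exact h.trans (hexp _ (by linarith [log_one_add_le_cubic hε0.le]))
  · have h := measureReal_sum_inner_sq_le (ι := Fin k) hu hε0.le hε1
    rw [Fintype.card_fin] at h
    exact h.trans (hexp _ (by linarith [log_one_sub_le_quadratic hε0.le hε1, pow_pos hε0 3]))

/-- Johnson–Lindenstrauss lemma: for any `0 < ε < 1` and integer `n ≥ 2`, if
`d' ≥ 24 log n / (3ε² − 2ε³)`, then for any set `A` of `n` points in `ℝ^d`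
there is a map `f : ℝ^d → ℝ^{d'}` with
`(1−ε)‖x−y‖² ≤ ‖f x − f y‖² ≤ (1+ε)‖x−y‖²` for all `x, y ∈ A`. -/
theorem stmt_13 (ε : ℝ) (hε0 : 0 < ε) (hε1 : ε < 1) (n : ℕ) (hn : 2 ≤ n)
    (d d' : ℕ) (hd' : (d' : ℝ) ≥ 24 * Real.log n / (3 * ε ^ 2 - 2 * ε ^ 3))
    (A : Finset (EuclideanSpace ℝ (Fin d))) (hA : A.card = n) :
    ∃ f : EuclideanSpace ℝ (Fin d) → EuclideanSpace ℝ (Fin d'),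
      ∀ x ∈ A, ∀ y ∈ A,
        (1 - ε) * ‖x - y‖ ^ 2 ≤ ‖f x - f y‖ ^ 2 ∧
          ‖f x - f y‖ ^ 2 ≤ (1 + ε) * ‖x - y‖ ^ 2 := by
  classical
  have hn2 : (2 : ℝ) ≤ n := by exact_mod_cast hn
  have hpos : (0 : ℝ) < d' := by
    have hden : 0 < 3 * ε ^ 2 - 2 * ε ^ 3 := by nlinarith [pow_pos hε0 2]
    have := Real.log_pos (by linarith : (1 : ℝ) < n)
    exact lt_of_lt_of_le (by positivity) hd'
  let μ : Measure (Fin d' → EuclideanSpace ℝ (Fin d)) := Measure.pi fun _ ↦ stdGaussian _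
  let q (v : EuclideanSpace ℝ (Fin d)) (g : Fin d' → EuclideanSpace ℝ (Fin d)) : ℝ :=
    ∑ i, (inner ℝ v (g i)) ^ 2
  -- An auxiliary well-order assigns the two one-sided bounds of an unordered pair
  -- to its two orderings.
  let bad (p : EuclideanSpace ℝ (Fin d) × EuclideanSpace ℝ (Fin d)) :
      Set (Fin d' → EuclideanSpace ℝ (Fin d)) :=
    if WellOrderingRel p.1 p.2 then {g | d' * (1 + ε) * ‖p.1 - p.2‖ ^ 2 ≤ q (p.1 - p.2) g}
    else {g | q (p.1 - p.2) g ≤ d' * (1 - ε) * ‖p.1 - p.2‖ ^ 2}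
  have hbad : ∀ p ∈ A.offDiag, μ.real (bad p) ≤ 1 / (n : ℝ) ^ 2 := by
    intro p hp
    have hne : p.1 - p.2 ≠ 0 := sub_ne_zero.2 (Finset.mem_offDiag.1 hp).2.2
    have h := measureReal_distortion_le hε0 hε1 (by omega) hd' hne
    simp only [bad]
    split_ifs
    exacts [h.1, h.2]
  have hunion : μ.real (⋃ p ∈ A.offDiag, bad p) < 1 := by
    refine (measureReal_biUnion_finset_le _ _).trans_lt ((Finset.sum_le_sum hbad).trans_lt ?_)
    rw [Finset.sum_const, Finset.offDiag_card, hA, nsmul_eq_mul,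
      Nat.cast_sub (Nat.le_mul_self n), Nat.cast_mul, mul_one_div, div_lt_one (by positivity)]
    linarith
  obtain ⟨g, hg⟩ : ∃ g, g ∉ ⋃ p ∈ A.offDiag, bad p := by
    by_contra! h
    rw [Set.eq_univ_of_forall h, probReal_univ] at hunion
    exact lt_irrefl _ hunion
  simp only [Set.mem_iUnion, not_exists] at hg
  have hq : ∀ x y, q (x - y) g = q (y - x) g := by
    intro x y
    simp only [q, ← neg_sub y x, inner_neg_left, neg_sq]
  have hgood : ∀ x ∈ A, ∀ y ∈ A, WellOrderingRel x y →
      d' * (1 - ε) * ‖x - y‖ ^ 2 ≤ q (x - y) g ∧ q (x - y) g ≤ d' * (1 + ε) * ‖x - y‖ ^ 2 := by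
    intro x hx y hy hxy
    have hne : x ≠ y := by
      rintro rfl
      exact irrefl_of WellOrderingRel x hxy
    have h1 := hg (x, y) (Finset.mem_offDiag.2 ⟨hx, hy, hne⟩)
    have h2 := hg (y, x) (Finset.mem_offDiag.2 ⟨hy, hx, hne.symm⟩)
    simp only [bad, if_pos hxy, if_neg (asymm_of WellOrderingRel hxy), Set.mem_ofPred_eq,
      not_le, hq y x, norm_sub_rev y x] at h1 h2
    exact ⟨h2.le, h1.le⟩
  refine ⟨fun x ↦ WithLp.toLp 2 fun i ↦ inner ℝ x (g i) / √d', fun x hx y hy ↦ ?_⟩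
  have hnorm : ‖(WithLp.toLp 2 fun i ↦ inner ℝ x (g i) / √d' : EuclideanSpace ℝ (Fin d'))
      - WithLp.toLp 2 fun i ↦ inner ℝ y (g i) / √d'‖ ^ 2 = q (x - y) g / d' := by
    simp only [EuclideanSpace.norm_sq_eq, q, PiLp.sub_apply, ← sub_div, ← inner_sub_left,
      Real.norm_eq_abs, sq_abs, div_pow, Real.sq_sqrt hpos.le, Finset.sum_div]
  rw [hnorm, le_div_iff₀ hpos, div_le_iff₀ hpos]
  have key : d' * (1 - ε) * ‖x - y‖ ^ 2 ≤ q (x - y) g ∧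
      q (x - y) g ≤ d' * (1 + ε) * ‖x - y‖ ^ 2 := by
    rcases trichotomous_of WellOrderingRel x y with h | rfl | h
    · exact hgood x hx y hy h
    · simp [q]
    · rw [hq, norm_sub_rev]
      exact hgood y hy x hx h
  constructor <;> linarith [key.1, key.2]
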